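/- arXiv:2406.18299 — 2 statements merged into one kernel-verified Lean document; each statement's English description precedes it below -/
import Mathlib

section
/- If there is a set C ⊆ S with |C| ≤ k that covers U, then the induced subgraph G′ ∖ C satisfies property R; in particular, there is then a set D of at most k vertices of G′ such that G′ ∖ D satisfies property R. -/
/-- The vertex set of `G′`: for every `s ∈ S` the four vertices `s, s′, s″, s‴`
(encoded as `(s, 0), (s, 1), (s, 2), (s, 3)`), and for every `u ∈ U` the `k+1`
vertices `u₁, …, u_{k+1}`. -/
def Vert (S U : Type*) (k : ℕ) : Type _ := (S × Fin 4) ⊕ (U × Fin (k + 1))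

/-- The edges of `G′`: for every `s ∈ S` the 4-cycle `{s,s′},{s′,s″},{s″,s‴},{s‴,s}`,
and whenever `s ∈ S` and `u ∈ U` are adjacent in `B`, the edges `{uᵢ, s}` and
`{uᵢ, s′}` for all `i`. -/
inductive GRel {S U : Type*} (B : S → U → Prop) (k : ℕ) : Vert S U k → Vert S U k → Prop
  | cyc (s : S) (i : Fin 4) : GRel B k (Sum.inl (s, i)) (Sum.inl (s, i + 1))
  | cov₀ {s : S} {u : U} (i : Fin (k + 1)) : B s u →
      GRel B k (Sum.inr (u, i)) (Sum.inl (s, 0))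
  | cov₁ {s : S} {u : U} (i : Fin (k + 1)) : B s u →
      GRel B k (Sum.inr (u, i)) (Sum.inl (s, 1))

/-- Property `R` of an undirected simple graph `H`: every vertex `x` has a vertex `y`
such that for every `z`, either `x ∼ y` and (`y ∼ z → x ≁ z`), or `x = z`. -/
def PropR {X : Type*} (H : SimpleGraph X) : Prop :=
  ∀ x : X, ∃ y : X, ∀ z : X, (H.Adj x y ∧ (H.Adj y z → ¬ H.Adj x z)) ∨ x = z

lemma gadj_ll {S U : Type*} (B : S → U → Prop) (k : ℕ) (s t : S) (i j : Fin 4) :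
    (SimpleGraph.fromRel (GRel B k)).Adj (Sum.inl (s, i)) (Sum.inl (t, j)) ↔
      s = t ∧ (j = i + 1 ∨ i = j + 1) := by
  refine Iff.trans (SimpleGraph.fromRel_adj ..) ?_
  constructor
  · rintro ⟨-, h | h⟩
    · cases h; simp
    · cases h; simp
  · rintro ⟨rfl, h⟩
    refine ⟨?_, ?_⟩
    · intro e
      have e2 : i = j := (Prod.mk.inj (Sum.inl.inj e)).2
      subst e2
      clear e; revert h; revert i; decide
    · rcases h with rfl | rfl
      · exact Or.inl (GRel.cyc _ _)
      · exact Or.inr (GRel.cyc _ _)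

lemma gadj_rl {S U : Type*} (B : S → U → Prop) (k : ℕ) (u : U) (t : S) (i : Fin (k + 1))
    (j : Fin 4) :
    (SimpleGraph.fromRel (GRel B k)).Adj (Sum.inr (u, i)) (Sum.inl (t, j)) ↔
      B t u ∧ (j = 0 ∨ j = 1) := by
  refine Iff.trans (SimpleGraph.fromRel_adj ..) ?_
  constructor
  · rintro ⟨-, h | h⟩
    · cases h <;> simp_all
    · cases h
  · rintro ⟨h, rfl | rfl⟩
    · exact ⟨(fun e => Sum.inr_ne_inl e), Or.inl (GRel.cov₀ _ h)⟩
    · exact ⟨(fun e => Sum.inr_ne_inl e), Or.inl (GRel.cov₁ _ h)⟩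

lemma gadj_rr {S U : Type*} (B : S → U → Prop) (k : ℕ) (u t : U) (i j : Fin (k + 1)) :
    ¬ (SimpleGraph.fromRel (GRel B k)).Adj (Sum.inr (u, i)) (Sum.inr (t, j)) := by
  refine fun h => absurd ((SimpleGraph.fromRel_adj ..).1 h) ?_
  rintro ⟨-, h | h⟩ <;> cases h

lemma gadj_lr {S U : Type*} (B : S → U → Prop) (k : ℕ) (u : U) (t : S) (i : Fin (k + 1))
    (j : Fin 4) :
    (SimpleGraph.fromRel (GRel B k)).Adj (Sum.inl (t, j)) (Sum.inr (u, i)) ↔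
      B t u ∧ (j = 0 ∨ j = 1) := by
  exact Iff.trans (SimpleGraph.adj_comm ..) (gadj_rl ..)

lemma propR_aux {S U : Type*} (B : S → U → Prop) (k : ℕ)
    (C : Set S) (hcov : ∀ u : U, ∃ s ∈ C, B s u) :
    PropR ((SimpleGraph.fromRel (GRel B k)).induce
        {v : Vert S U k | ∃ c ∈ C, v = Sum.inl (c, 0)}ᶜ) := by
  have hne : ∀ (s : S) (i : Fin 4), i ≠ 0 → (Sum.inl (s, i) : Vert S U k) ∈
      {v : Vert S U k | ∃ c ∈ C, v = Sum.inl (c, 0)}ᶜ := by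
    rintro s i hi ⟨c, -, h⟩
    exact hi (Prod.mk.inj (Sum.inl.inj h)).2
  rintro ⟨⟨s, i⟩ | ⟨u, i⟩, hx⟩
  · have key : ∀ y : Fin 4, y ≠ 0 → y ≠ 1 → (y = i + 1 ∨ i = y + 1) →
        (∀ j : Fin 4, (j = y + 1 ∨ y = j + 1) → ¬ (j = i + 1 ∨ i = j + 1)) →
        ∃ y, ∀ z, (((SimpleGraph.fromRel (GRel B k)).induce
          {v : Vert S U k | ∃ c ∈ C, v = Sum.inl (c, 0)}ᶜ).Adj ⟨Sum.inl (s, i), hx⟩ y ∧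
          (((SimpleGraph.fromRel (GRel B k)).induce
          {v : Vert S U k | ∃ c ∈ C, v = Sum.inl (c, 0)}ᶜ).Adj y z →
          ¬ ((SimpleGraph.fromRel (GRel B k)).induce
          {v : Vert S U k | ∃ c ∈ C, v = Sum.inl (c, 0)}ᶜ).Adj ⟨Sum.inl (s, i), hx⟩ z))
          ∨ ⟨Sum.inl (s, i), hx⟩ = z := by
      intro y h0 h1 hy hj
      refine ⟨⟨Sum.inl (s, y), hne s y h0⟩, fun z => Or.inl ⟨(gadj_ll ..).2 ⟨rfl, hy⟩, ?_⟩⟩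
      obtain ⟨⟨t, j⟩ | ⟨w, j⟩, hz⟩ := z
      · intro a b
        exact hj j ((gadj_ll ..).1 a).2 ((gadj_ll ..).1 b).2
      · intro a
        have := ((gadj_lr ..).1 a).2
        tauto
    have hi : i = 0 ∨ i = 1 ∨ i = 2 ∨ i = 3 := by
      have : ∀ i : Fin 4, i = 0 ∨ i = 1 ∨ i = 2 ∨ i = 3 := by decide
      exact this i
    rcases hi with rfl | rfl | rfl | rfl
    · exact key 3 (by decide) (by decide) (by decide) (by decide)
    · exact key 2 (by decide) (by decide) (by decide) (by decide)
    · exact key 3 (by decide) (by decide) (by decide) (by decide)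
    · exact key 2 (by decide) (by decide) (by decide) (by decide)
  · obtain ⟨s, hs, hsu⟩ := hcov u
    refine ⟨⟨Sum.inl (s, 1), hne s 1 (by decide)⟩,
      fun z => Or.inl ⟨(gadj_rl ..).2 ⟨hsu, Or.inr rfl⟩, ?_⟩⟩
    obtain ⟨⟨t, j⟩ | ⟨w, j⟩, hz⟩ := z
    · intro a b
      obtain ⟨rfl, a2⟩ := (gadj_ll ..).1 a
      have b := ((gadj_rl ..).1 b).2
      have hj : j = 0 := by
        have : ∀ j : Fin 4, (j = 1 + 1 ∨ 1 = j + 1) → (j = 0 ∨ j = 1) → j = 0 := by decide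
        exact this j a2 b
      subst hj
      exact hz ⟨s, hs, rfl⟩
    · intro _ b
      exact gadj_rr _ _ _ _ _ _ b

/-- if `C ⊆ S` with `|C| ≤ k` covers `U`, then `G′ ∖ C` satisfies
property `R`; in particular, there is a set `D` of at most `k` vertices of `G′` with
`G′ ∖ D` satisfying property `R`. -/
theorem stmt_11 {S U : Type*} [Finite S] [Finite U] (B : S → U → Prop) (k : ℕ)
    (hB : ∀ u : U, ∃ s : S, B s u)
    (C : Set S) (hC : C.ncard ≤ k) (hcov : ∀ u : U, ∃ s ∈ C, B s u) :
    PropR ((SimpleGraph.fromRel (GRel B k)).induce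
        {v : Vert S U k | ∃ c ∈ C, v = Sum.inl (c, 0)}ᶜ) ∧
      ∃ D : Set (Vert S U k), D.ncard ≤ k ∧
        PropR ((SimpleGraph.fromRel (GRel B k)).induce Dᶜ) := by
  refine ⟨propR_aux B k C hcov, _, ?_, propR_aux B k C hcov⟩
  have : {v : Vert S U k | ∃ c ∈ C, v = Sum.inl (c, 0)} =
      (fun c : S => (Sum.inl (c, 0) : Vert S U k)) '' C := by
    ext v
    constructor
    · rintro ⟨c, hc, rfl⟩; exact ⟨c, hc, rfl⟩
    · rintro ⟨c, hc, rfl⟩; exact ⟨c, hc, rfl⟩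
  rw [this]
  exact (Set.ncard_image_le (Set.toFinite C)).trans hC
end

section
/- If there is a set D of at most k vertices of G′ such that the induced subgraph G′ ∖ D satisfies property R, then there is a set C ⊆ S with |C| ≤ k that covers U. -/
/-- if there is a set `D` of at most `k` vertices of `G′` such that
`G′ ∖ D` satisfies property `R`, then there is a set `C ⊆ S` with `|C| ≤ k` that
covers `U`. -/
theorem stmt_12 {S U : Type*} [Finite S] [Finite U] (B : S → U → Prop) (k : ℕ)
    (hB : ∀ u : U, ∃ s : S, B s u)
    (hdel : ∃ D : Set (Vert S U k), D.ncard ≤ k ∧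
      PropR ((SimpleGraph.fromRel (GRel B k)).induce Dᶜ)) :
    ∃ C : Set S, C.ncard ≤ k ∧ ∀ u : U, ∃ s ∈ C, B s u := by
  classical
  obtain ⟨D, hD, hR⟩ := hdel
  haveI : Finite (Vert S U k) := by unfold Vert; infer_instance
  have hfin : D.Finite := Set.toFinite D
  refine ⟨{s | ∃ j : Fin 4, (Sum.inl (s, j) : Vert S U k) ∈ D}, ?_, ?_⟩
  · refine le_trans ?_ hD
    have key : ∀ s : S, ∃ j : Fin 4, (∃ j : Fin 4, (Sum.inl (s, j) : Vert S U k) ∈ D) →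
        (Sum.inl (s, j) : Vert S U k) ∈ D := by
      intro s
      by_cases h : ∃ j : Fin 4, (Sum.inl (s, j) : Vert S U k) ∈ D
      · obtain ⟨j, hj⟩ := h
        exact ⟨j, fun _ => hj⟩
      · exact ⟨0, fun h' => absurd h' h⟩
    choose f hf using key
    refine Set.ncard_le_ncard_of_injOn (fun s => (Sum.inl (s, f s) : Vert S U k))
      (fun s hs => hf s hs) ?_ hfin
    intro a _ b _ hab
    exact congrArg Prod.fst (Sum.inl.inj hab)
  · intro u
    obtain ⟨i, hi⟩ : ∃ i : Fin (k + 1), (Sum.inr (u, i) : Vert S U k) ∉ D := by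
      by_contra! hcon
      have h1 : (Set.univ : Set (Fin (k + 1))).ncard ≤ D.ncard := by
        refine Set.ncard_le_ncard_of_injOn (fun i => (Sum.inr (u, i) : Vert S U k))
          (fun i _ => hcon i) ?_ hfin
        intro a _ b _ hab
        exact congrArg Prod.snd (Sum.inr.inj hab)
      rw [Set.ncard_univ, Nat.card_eq_fintype_card, Fintype.card_fin] at h1
      omega
    by_contra! hno
    have hnot : ∀ s, B s u → ∀ j : Fin 4, (Sum.inl (s, j) : Vert S U k) ∉ D :=
      fun s hs j hj => hno s ⟨j, hj⟩ hs
    obtain ⟨⟨y, hyD⟩, hy⟩ := hR ⟨Sum.inr (u, i), hi⟩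
    obtain ⟨s₀, hs₀⟩ := hB u
    have hadj : (SimpleGraph.fromRel (GRel B k)).Adj (Sum.inr (u, i)) y := by
      rcases hy ⟨Sum.inl (s₀, 0), hnot s₀ hs₀ 0⟩ with h | h
      · exact h.1
      · exact absurd (congrArg Subtype.val h) Sum.inr_ne_inl
    have a01 : ∀ s, (SimpleGraph.fromRel (GRel B k)).Adj (Sum.inl (s, 0)) (Sum.inl (s, 1)) := by
      intro s
      refine (SimpleGraph.fromRel_adj _ _ _).2 ⟨?_, Or.inl (GRel.cyc s 0)⟩
      intro h
      exact absurd (congrArg Prod.snd (Sum.inl.inj h)) (by simp)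
    have au0 : ∀ s, B s u →
        (SimpleGraph.fromRel (GRel B k)).Adj (Sum.inr (u, i)) (Sum.inl (s, 0)) := fun s hs =>
      (SimpleGraph.fromRel_adj _ _ _).2 ⟨Sum.inr_ne_inl, Or.inl (GRel.cov₀ i hs)⟩
    have au1 : ∀ s, B s u →
        (SimpleGraph.fromRel (GRel B k)).Adj (Sum.inr (u, i)) (Sum.inl (s, 1)) := fun s hs =>
      (SimpleGraph.fromRel_adj _ _ _).2 ⟨Sum.inr_ne_inl, Or.inl (GRel.cov₁ i hs)⟩
    rcases ((SimpleGraph.fromRel_adj _ _ _).1 hadj).2 with h | h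
    · cases h with
      | @cov₀ s _ _ hs =>
        rcases hy ⟨Sum.inl (s, 1), hnot s hs 1⟩ with h | h
        · exact h.2 (a01 s) (au1 s hs)
        · exact absurd (congrArg Subtype.val h) Sum.inr_ne_inl
      | @cov₁ s _ _ hs =>
        rcases hy ⟨Sum.inl (s, 0), hnot s hs 0⟩ with h | h
        · exact h.2 (a01 s).symm (au0 s hs)
        · exact absurd (congrArg Subtype.val h) Sum.inr_ne_inl
    · cases h
end
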